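/- For all reals u, v and every 2×2 complex matrix ρ, (1/|C|) Σ_{c∈C} c† N_(u,v)(c ρ c†) c = N_{p(u,v)}(ρ), where p(u,v) = 1 − cos²(u/2)·cos²(v/2). Equivalently, tracing out the flag system of the flagged channel T^dep_(u,v) yields the depolarizing channel N_{p(u,v)}. -/

import Mathlib

open scoped Matrix Kronecker ComplexOrder

/-- A finite family of Kraus operators from input space `A` to output space `B`. -/
structure KrausFamily (A B : Type) [Fintype A] [DecidableEq A] [Fintype B] [DecidableEq B] :
    Type 1 where
  ι : Type
  [fι : Fintype ι]
  [dι : DecidableEq ι]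
  K : ι → Matrix B A ℂ

attribute [instance] KrausFamily.fι KrausFamily.dι

variable {A B : Type} [Fintype A] [DecidableEq A] [Fintype B] [DecidableEq B]

/-- The trace-preservation condition `Σ Kᵢ† Kᵢ = 1` making a Kraus family a quantum channel. -/
def KrausFamily.IsChannel (N : KrausFamily A B) : Prop :=
  ∑ i, (N.K i)ᴴ * N.K i = 1

/-- The action of a channel: `N(ρ) = Σ Kᵢ ρ Kᵢ†`. -/
noncomputable def KrausFamily.apply (N : KrausFamily A B) (ρ : Matrix A A ℂ) : Matrix B B ℂ :=
  ∑ i, N.K i * ρ * (N.K i)ᴴ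

/-- The complementary channel: `N̂(ρ)ᵢⱼ = Tr (Kᵢ ρ Kⱼ†)`. -/
noncomputable def KrausFamily.compl (N : KrausFamily A B) (ρ : Matrix A A ℂ) :
    Matrix N.ι N.ι ℂ :=
  Matrix.of fun i j => (N.K i * ρ * (N.K j)ᴴ).trace

/-- Von Neumann entropy, base 2: `S(ρ) = −Σ λⱼ log₂ λⱼ` over the eigenvalues of `ρ`
(junk value `0` for non-Hermitian matrices). -/
noncomputable def vnEntropy {n : Type} [Fintype n] [DecidableEq n] (ρ : Matrix n n ℂ) : ℝ :=
  if h : ρ.IsHermitian then -∑ j, h.eigenvalues j * Real.logb 2 (h.eigenvalues j) else 0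

/-- A density matrix: positive semidefinite with unit trace. -/
def IsDensity {n : Type} [Fintype n] (ρ : Matrix n n ℂ) : Prop :=
  ρ.PosSemidef ∧ ρ.trace = 1

/-- Coherent information of `N` at input `φ`: `I^c(N,φ) = S(N(φ)) − S(N̂(φ))`. -/
noncomputable def cohInfo (N : KrausFamily A B) (φ : Matrix A A ℂ) : ℝ :=
  vnEntropy (N.apply φ) - vnEntropy (N.compl φ)

/-- One-shot quantum capacity: `Q^{(1)}(N) = sup_φ I^c(N,φ)` over density matrices `φ`. -/
noncomputable def Q1 (N : KrausFamily A B) : ℝ :=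
  sSup {x | ∃ φ : Matrix A A ℂ, IsDensity φ ∧ x = cohInfo N φ}

/-- The `n`-th tensor power of a Kraus family, whose Kraus operators are all `n`-fold
Kronecker products of Kraus operators of `N`. -/
noncomputable def KrausFamily.pow (N : KrausFamily A B) (n : ℕ) :
    KrausFamily (Fin n → A) (Fin n → B) where
  ι := Fin n → N.ι
  K f := Matrix.of fun b a => ∏ i, N.K (f i) (b i) (a i)

/-- Quantum capacity: `Q(N) = sup_{n ≥ 1} (1/n) Q^{(1)}(N^{⊗n})`. -/
noncomputable def Qcap (N : KrausFamily A B) : ℝ :=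
  sSup {x | ∃ n : ℕ, 0 < n ∧ x = (1 / (n : ℝ)) * Q1 (N.pow n)}

/-- `N` is degradable if some channel `D` maps its output to its complementary output. -/
def KrausFamily.IsDegradable (N : KrausFamily A B) : Prop :=
  ∃ D : KrausFamily B N.ι, D.IsChannel ∧ ∀ ρ : Matrix A A ℂ, D.apply (N.apply ρ) = N.compl ρ

/-- `N` is antidegradable if some channel `D` maps its complementary output to its output. -/
def KrausFamily.IsAntidegradable (N : KrausFamily A B) : Prop :=
  ∃ D : KrausFamily N.ι B, D.IsChannel ∧ ∀ ρ : Matrix A A ℂ, D.apply (N.compl ρ) = N.apply ρ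

/-- The Hadamard matrix `H = (1/√2)[[1,1],[1,−1]]`. -/
noncomputable def Had : Matrix (Fin 2) (Fin 2) ℂ :=
  ((Real.sqrt 2)⁻¹ : ℂ) • !![1, 1; 1, -1]

/-- The phase matrix `S = diag(1, i)`. -/
def Sgate : Matrix (Fin 2) (Fin 2) ℂ := !![1, 0; 0, Complex.I]

/-- `c : Fin 24 → M₂(ℂ)` is a family of representatives of the single-qubit Clifford
group, the 24-element group (modulo global phase) generated by the Hadamard matrix and the
phase matrix: every `c i` is unitary and lies, up to a phase, in the group generated by
`H` and `S`, and every element of that group is a phase times exactly one `c i`. -/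
def IsCliffordFamily (c : Fin 24 → Matrix (Fin 2) (Fin 2) ℂ) : Prop :=
  (∀ i, c i ∈ Matrix.unitaryGroup (Fin 2) ℂ) ∧
  (∀ i, ∃ z : ℂ, z • c i ∈ Submonoid.closure {Had, Sgate}) ∧
  (∀ u ∈ Submonoid.closure {Had, Sgate}, ∃! i, ∃ z : ℂ, u = z • c i)

/-- The Kraus operator `A₊` of the channel `N_(u,v)`. -/
noncomputable def Aplus (u v : ℝ) : Matrix (Fin 2) (Fin 2) ℂ :=
  !![((Real.cos ((v - u) / 2) : ℝ) : ℂ), 0; 0, ((Real.cos ((v + u) / 2) : ℝ) : ℂ)]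

/-- The Kraus operator `A₋` of the channel `N_(u,v)`. -/
noncomputable def Aminus (u v : ℝ) : Matrix (Fin 2) (Fin 2) ℂ :=
  !![0, ((Real.sin ((v + u) / 2) : ℝ) : ℂ); ((Real.sin ((v - u) / 2) : ℝ) : ℂ), 0]

/-- The two-parameter qubit channel `N_(u,v)` with Kraus operators `A₊`, `A₋`. -/
noncomputable def Nuv (u v : ℝ) : KrausFamily (Fin 2) (Fin 2) where
  ι := Fin 2
  K := ![Aplus u v, Aminus u v]

/-- The flagged channel `T^dep_(u,v)(ρ) = (1/|C|) Σ_{c ∈ C} c† N_(u,v)(c ρ c†) c ⊗ |c⟩⟨c|`,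
with Kraus operators `(1/√|C|) c† A_± c ⊗ |c⟩` for `c` running over a family of
representatives of the Clifford group. -/
noncomputable def Tdep (u v : ℝ) (c : Fin 24 → Matrix (Fin 2) (Fin 2) ℂ) :
    KrausFamily (Fin 2) (Fin 2 × Fin 24) where
  ι := Fin 24 × Fin 2
  K x := Matrix.of fun bf a =>
    if bf.2 = x.1 then
      ((Real.sqrt 24)⁻¹ : ℂ) * ((c x.1)ᴴ * (![Aplus u v, Aminus u v] x.2) * c x.1) bf.1 a
    else 0

/-- Binary entropy `H(x) = −x log₂ x − (1−x) log₂ (1−x)`. -/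
noncomputable def binEnt (x : ℝ) : ℝ :=
  -x * Real.logb 2 x - (1 - x) * Real.logb 2 (1 - x)

/-- Pauli `X`. -/
def PauliX : Matrix (Fin 2) (Fin 2) ℂ := !![0, 1; 1, 0]

/-- Pauli `Y`. -/
def PauliY : Matrix (Fin 2) (Fin 2) ℂ := !![0, -Complex.I; Complex.I, 0]

/-- Pauli `Z`. -/
def PauliZ : Matrix (Fin 2) (Fin 2) ℂ := !![1, 0; 0, -1]

/-- Action of the depolarizing channel with error probability `p`. -/
noncomputable def depolAction (p : ℝ) (ρ : Matrix (Fin 2) (Fin 2) ℂ) :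
    Matrix (Fin 2) (Fin 2) ℂ :=
  ((1 - p : ℝ) : ℂ) • ρ + ((p / 3 : ℝ) : ℂ) • (PauliX * ρ * PauliX) +
    ((p / 3 : ℝ) : ℂ) • (PauliY * ρ * PauliY) + ((p / 3 : ℝ) : ℂ) • (PauliZ * ρ * PauliZ)

/-- Partial trace over a flag system carried as the second tensor factor. -/
noncomputable def trFlag {B : Type} [Fintype B] {m : ℕ}
    (M : Matrix (B × Fin m) (B × Fin m) ℂ) : Matrix B B ℂ :=
  Matrix.of fun a b => ∑ i, M (a, i) (b, i)

lemma closure_Had_Sgate_le_unitaryGroup :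
    Submonoid.closure {Had, Sgate} ≤ Matrix.unitaryGroup (Fin 2) ℂ := by
  have h2 : ((√2 : ℝ) : ℂ) * ((√2 : ℝ) : ℂ) = 2 := by
    rw [← Complex.ofReal_mul, Real.mul_self_sqrt (by norm_num)]; norm_num
  have h0 : ((√2 : ℝ) : ℂ) ≠ 0 := fun h => by simp [h] at h2
  rw [Submonoid.closure_le]
  rintro g (rfl | rfl)
  · rw [SetLike.mem_coe, Matrix.mem_unitaryGroup_iff]
    ext i j
    fin_cases i <;> fin_cases j <;>
      simp [Had, Matrix.mul_apply, Matrix.star_apply] <;>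
      field_simp <;> linear_combination -h2
  · rw [SetLike.mem_coe, Matrix.mem_unitaryGroup_iff]
    ext i j
    fin_cases i <;> fin_cases j <;> simp [Sgate, Matrix.mul_apply, Matrix.star_apply]

lemma star_mul_self_eq_one_of_unitary_eq_smul {U V : Matrix (Fin 2) (Fin 2) ℂ}
    (hU : U ∈ Matrix.unitaryGroup (Fin 2) ℂ) (hV : V ∈ Matrix.unitaryGroup (Fin 2) ℂ)
    {w : ℂ} (h : U = w • V) : star w * w = 1 := by
  rw [Matrix.mem_unitaryGroup_iff'] at hU hV
  rw [h, star_smul, smul_mul_smul_comm, hV] at hU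
  simpa using congrFun (congrFun hU 0) 0

namespace IsCliffordFamily

variable {c : Fin 24 → Matrix (Fin 2) (Fin 2) ℂ}

lemma ne_zero_of_eq_smul (hc : IsCliffordFamily c) {U : Matrix (Fin 2) (Fin 2) ℂ}
    (hU : U ∈ Matrix.unitaryGroup (Fin 2) ℂ) {i : Fin 24} {w : ℂ} (h : U = w • c i) :
    w ≠ 0 := by
  rintro rfl
  simpa using star_mul_self_eq_one_of_unitary_eq_smul hU (hc.1 i) h

/-- The representatives are pairwise inequivalent up to scalars. -/
lemma eq_of_eq_smul (hc : IsCliffordFamily c) {i j : Fin 24} {w : ℂ} (h : c i = w • c j) :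
    i = j := by
  obtain ⟨z, hz⟩ := hc.2.1 i
  exact (hc.2.2 _ hz).unique ⟨z, rfl⟩ ⟨z * w, by rw [h, smul_smul]⟩

/-- Right multiplication by a Clifford element permutes the representatives up to scalars. -/
lemma exists_mul_eq_smul (hc : IsCliffordFamily c) {g : Matrix (Fin 2) (Fin 2) ℂ}
    (hg : g ∈ Submonoid.closure {Had, Sgate}) :
    ∃ e : Fin 24 → Fin 24, e.Bijective ∧ ∀ i, ∃ w : ℂ, c i * g = w • c (e i) := by
  have hgU := closure_Had_Sgate_le_unitaryGroup hg
  have key : ∀ i, ∃ j, ∃ w : ℂ, c i * g = w • c j := by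
    intro i
    obtain ⟨z, hz⟩ := hc.2.1 i
    have hz0 := hc.ne_zero_of_eq_smul (closure_Had_Sgate_le_unitaryGroup hz) rfl
    obtain ⟨j, ⟨w, hw⟩, -⟩ := hc.2.2 _ (mul_mem hz hg)
    refine ⟨j, z⁻¹ * w, ?_⟩
    rw [mul_smul, ← hw, Matrix.smul_mul, inv_smul_smul₀ hz0]
  choose e he using key
  refine ⟨e, Finite.injective_iff_bijective.mp fun i j hij => ?_, he⟩
  obtain ⟨w, hw⟩ := he i
  obtain ⟨w', hw'⟩ := he j
  have hw0 := hc.ne_zero_of_eq_smul (mul_mem (hc.1 j) hgU) hw'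
  have hg1 : g * star g = 1 := Matrix.mem_unitaryGroup_iff.mp hgU
  refine hc.eq_of_eq_smul (w := w * w'⁻¹) ?_
  calc c i = c i * g * star g := by rw [mul_assoc, hg1, mul_one]
    _ = (w * w'⁻¹) • (c j * g) * star g := by
      rw [hw, hw', hij, smul_smul, mul_assoc, inv_mul_cancel₀ hw0, mul_one]
    _ = (w * w'⁻¹) • c j := by rw [Matrix.smul_mul, mul_assoc, hg1, mul_one]

/-- Twirled sums are invariant under conjugation by Clifford elements. -/
lemma sum_conj_conj (hc : IsCliffordFamily c) {g : Matrix (Fin 2) (Fin 2) ℂ}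
    (hg : g ∈ Submonoid.closure {Had, Sgate}) {M : Type*} [AddCommMonoid M]
    (F : Matrix (Fin 2) (Fin 2) ℂ → M) (T : Matrix (Fin 2) (Fin 2) ℂ) :
    ∑ i, F (gᴴ * ((c i)ᴴ * T * c i) * g) = ∑ i, F ((c i)ᴴ * T * c i) := by
  obtain ⟨e, he, hce⟩ := hc.exists_mul_eq_smul hg
  rw [← he.sum_comp fun i => F ((c i)ᴴ * T * c i)]
  refine Finset.sum_congr rfl fun i _ => congrArg F ?_
  obtain ⟨w, hw⟩ := hce i
  have hw1 := star_mul_self_eq_one_of_unitary_eq_smul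
    (mul_mem (hc.1 i) (closure_Had_Sgate_le_unitaryGroup hg)) (hc.1 (e i)) hw
  calc gᴴ * ((c i)ᴴ * T * c i) * g = (c i * g)ᴴ * T * (c i * g) := by
        rw [Matrix.conjTranspose_mul]; simp only [mul_assoc]
    _ = (c (e i))ᴴ * T * c (e i) := by
        rw [hw, Matrix.conjTranspose_smul, Matrix.smul_mul, Matrix.smul_mul, Matrix.mul_smul,
          smul_smul, hw1, one_smul]

end IsCliffordFamily

/-- The Pauli basis `1, X, Y, Z`. -/
def pauliBasis : Fin 4 → Matrix (Fin 2) (Fin 2) ℂ := ![1, PauliX, PauliY, PauliZ]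

/-- The coordinates of a matrix in the Pauli basis. -/
noncomputable def pauliCoord (T : Matrix (Fin 2) (Fin 2) ℂ) : Fin 4 → ℂ :=
  ![(T 0 0 + T 1 1) / 2, (T 0 1 + T 1 0) / 2, Complex.I * (T 0 1 - T 1 0) / 2,
    (T 0 0 - T 1 1) / 2]

lemma conjTranspose_pauliBasis (p : Fin 4) : (pauliBasis p)ᴴ = pauliBasis p := by
  ext i j
  fin_cases p <;> fin_cases i <;> fin_cases j <;>
    simp [pauliBasis, PauliX, PauliY, PauliZ, Matrix.conjTranspose_apply]

lemma sum_pauliCoord_smul (T : Matrix (Fin 2) (Fin 2) ℂ) :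
    ∑ p, pauliCoord T p • pauliBasis p = T := by
  have hI := Complex.I_mul_I
  ext i j
  fin_cases i <;> fin_cases j <;>
    simp [pauliBasis, pauliCoord, PauliX, PauliY, PauliZ, Fin.sum_univ_four] <;>
    grind

lemma pauliCoord_Sgate_conj (T : Matrix (Fin 2) (Fin 2) ℂ) :
    pauliCoord (Sgateᴴ * T * Sgate) =
      ![pauliCoord T 0, pauliCoord T 2, -pauliCoord T 1, pauliCoord T 3] := by
  have hI := Complex.I_mul_I
  ext p
  fin_cases p <;>
    simp [pauliCoord, Sgate, Matrix.mul_apply, Fin.sum_univ_two, Matrix.conjTranspose_apply] <;>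
    grind

lemma pauliCoord_Had_conj (T : Matrix (Fin 2) (Fin 2) ℂ) :
    pauliCoord (Hadᴴ * T * Had) =
      ![pauliCoord T 0, pauliCoord T 3, -pauliCoord T 2, pauliCoord T 1] := by
  have h2 : (((√2 : ℝ) : ℂ))⁻¹ * ((√2 : ℝ) : ℂ)⁻¹ = 1 / 2 := by
    rw [← mul_inv, ← Complex.ofReal_mul, Real.mul_self_sqrt (by norm_num)]; norm_num
  ext p
  fin_cases p <;>
    simp [pauliCoord, Had, Matrix.mul_apply, Fin.sum_univ_two, Matrix.conjTranspose_apply] <;>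
    grind

lemma pauliCoord_zero_conj {U : Matrix (Fin 2) (Fin 2) ℂ}
    (hU : U ∈ Matrix.unitaryGroup (Fin 2) ℂ) (T : Matrix (Fin 2) (Fin 2) ℂ) :
    pauliCoord (Uᴴ * T * U) 0 = pauliCoord T 0 := by
  have h (R : Matrix (Fin 2) (Fin 2) ℂ) : pauliCoord R 0 = R.trace / 2 := by
    simp [pauliCoord, Matrix.trace_fin_two]
  have hU' : U * Uᴴ = 1 := Matrix.mem_unitaryGroup_iff.mp hU
  rw [h, h, mul_assoc, Matrix.trace_mul_comm, mul_assoc, hU', mul_one]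

lemma sum_pauliCoord_mul_star (T : Matrix (Fin 2) (Fin 2) ℂ) :
    ∑ p, pauliCoord T p * star (pauliCoord T p) = (T * Tᴴ).trace / 2 := by
  have hI := Complex.I_mul_I
  have h2 : (starRingEnd ℂ) 2 = 2 := map_ofNat _ 2
  simp [pauliCoord, Fin.sum_univ_four, Matrix.trace_fin_two, Matrix.mul_apply,
    Matrix.conjTranspose_apply]
  grind

lemma sum_pauliCoord_mul_star_conj {U : Matrix (Fin 2) (Fin 2) ℂ}
    (hU : U ∈ Matrix.unitaryGroup (Fin 2) ℂ) (T : Matrix (Fin 2) (Fin 2) ℂ) :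
    ∑ p, pauliCoord (Uᴴ * T * U) p * star (pauliCoord (Uᴴ * T * U) p) =
      (T * Tᴴ).trace / 2 := by
  have hU' : U * Uᴴ = 1 := Matrix.mem_unitaryGroup_iff.mp hU
  rw [sum_pauliCoord_mul_star]
  congr 1
  calc (Uᴴ * T * U * (Uᴴ * T * U)ᴴ).trace = (Uᴴ * (T * (U * Uᴴ) * Tᴴ * U)).trace := by
        simp only [Matrix.conjTranspose_mul, Matrix.conjTranspose_conjTranspose, mul_assoc]
    _ = (T * Tᴴ).trace := by
        rw [Matrix.trace_mul_comm, hU', mul_one, mul_assoc, hU', mul_one]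

/-- The Pauli coordinates of a Clifford orbit have a diagonal second-moment matrix. -/
lemma IsCliffordFamily.sum_pauliCoord_mul_star {c : Fin 24 → Matrix (Fin 2) (Fin 2) ℂ}
    (hc : IsCliffordFamily c) (T : Matrix (Fin 2) (Fin 2) ℂ) (p q : Fin 4) :
    ∑ i, pauliCoord ((c i)ᴴ * T * c i) p * star (pauliCoord ((c i)ᴴ * T * c i) q) =
      if p = q then 24 * if p = 0 then pauliCoord T 0 * star (pauliCoord T 0)
        else ((T * Tᴴ).trace / 2 - pauliCoord T 0 * star (pauliCoord T 0)) / 3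
      else 0 := by
  obtain ⟨χ, hχ⟩ : ∃ χ : Fin 4 → Fin 4 → ℂ, ∀ p q, χ p q = ∑ i,
      pauliCoord ((c i)ᴴ * T * c i) p * star (pauliCoord ((c i)ᴴ * T * c i) q) :=
    ⟨_, fun _ _ => rfl⟩
  have hS (p q : Fin 4) := hc.sum_conj_conj (Submonoid.subset_closure (Or.inr rfl))
    (fun R => pauliCoord R p * star (pauliCoord R q)) T
  have hH (p q : Fin 4) := hc.sum_conj_conj (Submonoid.subset_closure (Or.inl rfl))
    (fun R => pauliCoord R p * star (pauliCoord R q)) T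
  simp only [pauliCoord_Sgate_conj] at hS
  simp only [pauliCoord_Had_conj] at hH
  have h00 : χ 0 0 = 24 * (pauliCoord T 0 * star (pauliCoord T 0)) := by
    simp [hχ, pauliCoord_zero_conj (hc.1 _)]
  have htr : χ 0 0 + χ 1 1 + χ 2 2 + χ 3 3 = 24 * ((T * Tᴴ).trace / 2) := by
    rw [← Fin.sum_univ_four fun p => χ p p]
    simp only [hχ]
    rw [Finset.sum_comm]
    simp only [sum_pauliCoord_mul_star_conj (hc.1 _)]
    simp
  have hS' (p q : Fin 4) : (![1, 1, -1, 1] p * ![1, 1, -1, 1] q : ℂ) *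
      χ (![0, 2, 1, 3] p) (![0, 2, 1, 3] q) = χ p q := by
    rw [hχ p q, ← hS p q, hχ, Finset.mul_sum]
    refine Finset.sum_congr rfl fun i _ => ?_
    fin_cases p <;> fin_cases q <;> simp
  have hH' (p q : Fin 4) : (![1, 1, -1, 1] p * ![1, 1, -1, 1] q : ℂ) *
      χ (![0, 3, 2, 1] p) (![0, 3, 2, 1] q) = χ p q := by
    rw [hχ p q, ← hH p q, hχ, Finset.mul_sum]
    refine Finset.sum_congr rfl fun i _ => ?_
    fin_cases p <;> fin_cases q <;> simp
  rw [← hχ]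
  clear hS hH hχ
  simp only [RCLike.star_def] at h00
  simp [Fin.forall_fin_succ] at hS' hH'
  fin_cases p <;> fin_cases q <;> simp <;> grind

/-- The Clifford twirl of a single Kraus operator. -/
lemma IsCliffordFamily.sum_twirl {c : Fin 24 → Matrix (Fin 2) (Fin 2) ℂ}
    (hc : IsCliffordFamily c) (T ρ : Matrix (Fin 2) (Fin 2) ℂ) :
    ∑ i, ((c i)ᴴ * T * c i) * ρ * ((c i)ᴴ * T * c i)ᴴ =
      (24 : ℂ) • ((pauliCoord T 0 * star (pauliCoord T 0)) • ρ +
        (((T * Tᴴ).trace / 2 - pauliCoord T 0 * star (pauliCoord T 0)) / 3) •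
          (PauliX * ρ * PauliX + PauliY * ρ * PauliY + PauliZ * ρ * PauliZ)) := by
  have expand (R : Matrix (Fin 2) (Fin 2) ℂ) : R * ρ * Rᴴ =
      ∑ p, ∑ q, (pauliCoord R p * star (pauliCoord R q)) •
        (pauliBasis p * ρ * pauliBasis q) := by
    conv_lhs => rw [← sum_pauliCoord_smul R]
    simp only [Matrix.conjTranspose_sum, Matrix.conjTranspose_smul, conjTranspose_pauliBasis,
      Finset.sum_mul, Finset.mul_sum, Matrix.smul_mul, Matrix.mul_smul, smul_smul]
    rw [Finset.sum_comm]
    simp only [mul_comm]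
  simp only [expand]
  rw [Finset.sum_comm]
  simp_rw [Finset.sum_comm (s := (Finset.univ : Finset (Fin 24))), ← Finset.sum_smul,
    hc.sum_pauliCoord_mul_star]
  simp [Fin.sum_univ_four, pauliBasis, smul_add, smul_smul, add_assoc]

lemma sum_twirl_Nuv (u v : ℝ) {c : Fin 24 → Matrix (Fin 2) (Fin 2) ℂ}
    (hc : IsCliffordFamily c) (ρ : Matrix (Fin 2) (Fin 2) ℂ) :
    (24 : ℂ)⁻¹ • ∑ i, ∑ k, ((c i)ᴴ * ![Aplus u v, Aminus u v] k * c i) * ρ *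
        ((c i)ᴴ * ![Aplus u v, Aminus u v] k * c i)ᴴ =
      depolAction (1 - Real.cos (u / 2) ^ 2 * Real.cos (v / 2) ^ 2) ρ := by
  have hp : pauliCoord (Aplus u v) 0 = ((Real.cos (u / 2) * Real.cos (v / 2) : ℝ) : ℂ) := by
    have h : (Real.cos ((v - u) / 2) + Real.cos ((v + u) / 2)) / 2 =
        Real.cos (u / 2) * Real.cos (v / 2) := by
      rw [sub_div v, add_div v, Real.cos_sub, Real.cos_add]; ring
    rw [← h]
    simp [pauliCoord, Aplus]
  have hm : pauliCoord (Aminus u v) 0 = 0 := by simp [pauliCoord, Aminus]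
  have htr : (Aplus u v * (Aplus u v)ᴴ).trace + (Aminus u v * (Aminus u v)ᴴ).trace = 2 := by
    have h1 := Real.sin_sq_add_cos_sq ((v - u) / 2)
    have h2 := Real.sin_sq_add_cos_sq ((v + u) / 2)
    simp only [Matrix.trace_fin_two, Matrix.mul_apply, Matrix.conjTranspose_apply,
      Fin.sum_univ_two]
    simp [Aplus, Aminus, -Complex.ofReal_cos, -Complex.ofReal_sin]
    norm_cast
    linear_combination h1 + h2
  rw [Finset.sum_comm, Fin.sum_univ_two]
  simp only [Matrix.cons_val_zero, Matrix.cons_val_one]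
  rw [hc.sum_twirl, hc.sum_twirl, ← smul_add, inv_smul_smul₀ (by norm_num), hp, hm,
    eq_sub_of_add_eq htr, depolAction]
  simp only [star_zero, mul_zero, zero_smul, sub_zero, zero_add, RCLike.star_def,
    Complex.conj_ofReal]
  push_cast
  module

/-- For all reals `u, v` and every `2×2` matrix `ρ`,
`(1/|C|) Σ_{c ∈ C} c† N_(u,v)(c ρ c†) c = N_{p(u,v)}(ρ)` with
`p(u,v) = 1 − cos²(u/2) cos²(v/2)`; equivalently, tracing out the flag system of the
flagged channel `T^dep_(u,v)` yields the depolarizing channel `N_{p(u,v)}`. -/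
theorem twirl_Nuv_eq_depolarizing (u v : ℝ)
    (c : Fin 24 → Matrix (Fin 2) (Fin 2) ℂ) (hc : IsCliffordFamily c)
    (ρ : Matrix (Fin 2) (Fin 2) ℂ) :
    ((24 : ℂ)⁻¹ • ∑ i, (c i)ᴴ * (Nuv u v).apply (c i * ρ * (c i)ᴴ) * c i =
      depolAction (1 - Real.cos (u / 2) ^ 2 * Real.cos (v / 2) ^ 2) ρ) ∧
    trFlag ((Tdep u v c).apply ρ) =
      depolAction (1 - Real.cos (u / 2) ^ 2 * Real.cos (v / 2) ^ 2) ρ := by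
  have key := sum_twirl_Nuv u v hc ρ
  refine ⟨?_, ?_⟩
  · rw [← key]
    congr 1
    refine Finset.sum_congr rfl fun i _ => ?_
    simp only [KrausFamily.apply, Finset.mul_sum, Finset.sum_mul]
    refine Finset.sum_congr rfl fun k _ => ?_
    simp only [Nuv, Matrix.conjTranspose_mul, Matrix.conjTranspose_conjTranspose, mul_assoc]
  · rw [← key]
    have h24 : (((√24 : ℝ) : ℂ))⁻¹ * ((√24 : ℝ) : ℂ)⁻¹ = 24⁻¹ := by
      rw [← mul_inv, ← Complex.ofReal_mul, Real.mul_self_sqrt (by norm_num)]; norm_num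
    have hK (i j : Fin 24) (k : Fin 2) (a b : Fin 2) :
        ((Tdep u v c).K (j, k) * ρ * ((Tdep u v c).K (j, k))ᴴ) (a, i) (b, i) =
          if i = j then (24 : ℂ)⁻¹ * (((c j)ᴴ * ![Aplus u v, Aminus u v] k * c j) * ρ *
            ((c j)ᴴ * ![Aplus u v, Aminus u v] k * c j)ᴴ) a b else 0 := by
      rw [← h24]
      generalize hR : (c j)ᴴ * ![Aplus u v, Aminus u v] k * c j = R
      have hT (x : Fin 2) (y : Fin 2) : (Tdep u v c).K (j, k) (x, i) y =
          if i = j then ((√24 : ℝ) : ℂ)⁻¹ * R x y else 0 := by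
        rw [← hR]; rfl
      simp only [Matrix.mul_apply, Matrix.conjTranspose_apply, hT, Fin.sum_univ_two]
      split_ifs
      · simp only [RCLike.star_def, map_mul, map_inv₀, Complex.conj_ofReal]
        ring
      · simp
    ext a b
    have hsum : (Tdep u v c).apply ρ = ∑ x : Fin 24 × Fin 2,
        (Tdep u v c).K x * ρ * ((Tdep u v c).K x)ᴴ := rfl
    simp only [trFlag, Matrix.of_apply, hsum, Matrix.sum_apply, Fintype.sum_prod_type, hK,
      Matrix.smul_apply, smul_eq_mul, Finset.mul_sum]
    refine Finset.sum_congr rfl fun i _ => ?_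
    rw [Finset.sum_comm]
    simp
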